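/- Let I be a finite set with |I| = N, and let A, B ≥ 0. For each i ∈ I let q_i ≥ 0, let a_i ∈ [0, A] and b_i ∈ [0, B] be real numbers, and set q_i' = max(q_i − b_i, 0) + a_i. Then Σ_{i ∈ I} ((1/2)·q_i'² − (1/2)·q_i²) ≤ (N/2)·(A² + B²) + Σ_{i ∈ I} q_i·(a_i − b_i). -/

import Mathlib

/-- One-slot quadratic Lyapunov drift bound for a system of `N` queues. -/
theorem stmt_9
    {α : Type*} (I : Finset α) (N : ℕ) (hN : I.card = N)
    (A B : ℝ) (hA : 0 ≤ A) (hB : 0 ≤ B)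
    (q a b q' : α → ℝ)
    (hq : ∀ i ∈ I, 0 ≤ q i)
    (ha : ∀ i ∈ I, 0 ≤ a i ∧ a i ≤ A)
    (hb : ∀ i ∈ I, 0 ≤ b i ∧ b i ≤ B)
    (hq' : ∀ i ∈ I, q' i = max (q i - b i) 0 + a i) :
    ∑ i ∈ I, ((1 / 2) * (q' i) ^ 2 - (1 / 2) * (q i) ^ 2) ≤
      (N / 2) * (A ^ 2 + B ^ 2) + ∑ i ∈ I, q i * (a i - b i) := by
  have key : ∀ i ∈ I, (1 / 2) * (q' i) ^ 2 - (1 / 2) * (q i) ^ 2 ≤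
      (1 / 2) * (A ^ 2 + B ^ 2) + q i * (a i - b i) := by
    intro i hi
    obtain ⟨ha0, haA⟩ := ha i hi
    obtain ⟨hb0, hbB⟩ := hb i hi
    have hq0 := hq i hi
    rw [hq' i hi]
    have h1 : (max (q i - b i) 0) ^ 2 ≤ (q i - b i) ^ 2 := by
      rcases max_cases (q i - b i) 0 with ⟨h, _⟩ | ⟨h, _⟩ <;> rw [h]
      nlinarith [sq_nonneg (q i - b i)]
    have h2 : max (q i - b i) 0 ≤ q i := max_le (by linarith) hq0
    have h3 := mul_le_mul_of_nonneg_right h2 ha0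
    have h4 : a i ^ 2 ≤ A ^ 2 := pow_le_pow_left₀ ha0 haA 2
    have h5 : b i ^ 2 ≤ B ^ 2 := pow_le_pow_left₀ hb0 hbB 2
    nlinarith
  refine (Finset.sum_le_sum key).trans (le_of_eq ?_)
  rw [Finset.sum_add_distrib, Finset.sum_const, hN, nsmul_eq_mul]
  ring
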